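/- Let Q ∈ H_𝔽 and suppose assumptions (A1)–(A5) hold. Given an initial condition x_0 ∈ ℝᴺ, there exists an optimal control v* ∈ H_𝔽ᴺ satisfying the balance condition (1/N) Σ_{i=1}^N v*ⁱ = Q and such that I_N[v*] ≤ I_N[v] for every v ∈ H_𝔽ᴺ satisfying the balance condition. -/

import Mathlib

/- STATEMENT 7: Existence of an optimal control for the constrained N-agent
   problem (minimization of I_N subject to the balance condition) under (A1)-(A5). -/

open MeasureTheory

noncomputable section

/-- Membership in the space `H_𝔽`: progressively measurable processes with
`E[∫_0^T v_t² dt] < ∞`. -/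
def MemH {Ω : Type*} {m : MeasurableSpace Ω} (P : Measure Ω) (T : ℝ)
    (𝔽 : Filtration ℝ m) (v : ℝ → Ω → ℝ) : Prop :=
  ProgMeasurable 𝔽 v ∧
    (∫⁻ ω, (∫⁻ t in Set.Ioc (0:ℝ) T, ENNReal.ofReal ((v t ω) ^ 2)) ∂P) < ⊤

/-- Trajectory `X_t = x₀ + ∫_0^t v_s ds`. -/
def traj {Ω : Type*} (x0 : ℝ) (v : ℝ → Ω → ℝ) (t : ℝ) (ω : Ω) : ℝ :=
  x0 + ∫ s in (0:ℝ)..t, v s ω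

/-- The product measure dt ⊗ dP on (0,T] × Ω. -/
def timeProd {Ω : Type*} {_m : MeasurableSpace Ω} (P : Measure Ω) (T : ℝ) :
    Measure (ℝ × Ω) :=
  (volume.restrict (Set.Ioc (0:ℝ) T)).prod P

/-- Balance condition: (1/N) Σᵢ vⁱ = Q in H_𝔽, i.e. (dt⊗dP)-a.e. -/
def Balance {Ω : Type*} {_m : MeasurableSpace Ω} (P : Measure Ω) (T : ℝ)
    (N : ℕ) (v : Fin N → ℝ → Ω → ℝ) (Q : ℝ → Ω → ℝ) : Prop :=
  (fun p : ℝ × Ω => (1 / (N:ℝ)) * ∑ i, v i p.1 p.2) =ᵐ[timeProd P T]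
    (fun p => Q p.1 p.2)

/-- The N-agent functional I_N. -/
def costN {Ω : Type*} {_m : MeasurableSpace Ω} (P : Measure Ω) (T : ℝ)
    (L : ℝ → ℝ → ℝ) (Ψ : ℝ → ℝ) (N : ℕ) (x0 : Fin N → ℝ)
    (v : Fin N → ℝ → Ω → ℝ) : ℝ :=
  (1 / (N:ℝ)) * ∑ i, ∫ ω, ((∫ t in Set.Ioc (0:ℝ) T,
      L (traj (x0 i) (v i) t ω) (v i t ω)) + Ψ (traj (x0 i) (v i) T ω)) ∂P
open Filter Topology
lemma absmin {E : Type*} (A : Set E) (hne : A.Nonempty) (mid : E → E → E) (J q : E → ℝ)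
    (D : E → E → ℝ) (c c' : ℝ)
    (hmid : ∀ a ∈ A, ∀ b ∈ A, mid a b ∈ A)
    (hJ0 : ∀ a, 0 ≤ J a) (hc : 0 ≤ c)
    (hJ : ∀ a ∈ A, ∀ b ∈ A, J (mid a b) ≤ (J a + J b) / 2)
    (hq0 : ∀ a, 0 ≤ q a)
    (hpar : ∀ a ∈ A, ∀ b ∈ A, D a b + 4 * q (mid a b) = 2 * q a + 2 * q b)
    (hco : ∀ a ∈ A, q a ≤ c * J a + c') :
    ∃ w : ℕ → E, (∀ n, w n ∈ A) ∧ (∀ n : ℕ, ∀ a ∈ A, J (w n) ≤ J a + 1 / ((n:ℝ) + 1)) ∧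
      ∀ ε > 0, ∃ n0, ∀ n ≥ n0, ∀ k ≥ n0, D (w n) (w k) ≤ ε := by
  set K : ℕ → Set E := fun n => {a | a ∈ A ∧ ∀ b ∈ A, J a ≤ J b + 1 / ((n:ℝ) + 1)} with hK
  have hpos : ∀ n : ℕ, 0 < 1 / ((n:ℝ) + 1) := fun n => Nat.one_div_pos_of_nat
  have hKne : ∀ n, (K n).Nonempty := by
    intro n
    have hbd : BddBelow (J '' A) := ⟨0, by rintro _ ⟨a, _, rfl⟩; exact hJ0 a⟩
    obtain ⟨_, ⟨a, ha, rfl⟩, h⟩ := exists_lt_of_csInf_lt (hne.image J)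
      (lt_add_of_pos_right (sInf (J '' A)) (hpos n))
    refine ⟨a, ha, fun b hb => ?_⟩
    have := csInf_le hbd ⟨b, hb, rfl⟩
    linarith
  have hKanti : ∀ n k, n ≤ k → K k ⊆ K n := by
    rintro n k hnk a ⟨ha, h⟩
    refine ⟨ha, fun b hb => (h b hb).trans ?_⟩
    have := Nat.one_div_le_one_div (α := ℝ) hnk
    linarith
  have hKmid : ∀ n, ∀ a ∈ K n, ∀ b ∈ K n, mid a b ∈ K n := by
    rintro n a ⟨ha, h⟩ b ⟨hb, h'⟩
    refine ⟨hmid a ha b hb, fun e he => ?_⟩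
    have := hJ a ha b hb
    have := h e he
    have := h' e he
    linarith
  set d : ℕ → ℝ := fun n => sInf (q '' K n)
  have hbq : ∀ n, BddBelow (q '' K n) := fun n => ⟨0, by rintro _ ⟨a, _, rfl⟩; exact hq0 a⟩
  have hdle : ∀ n, ∀ a ∈ K n, d n ≤ q a := fun n a ha => csInf_le (hbq n) ⟨a, ha, rfl⟩
  have hdmono : Monotone d := fun n k hnk =>
    csInf_le_csInf (hbq n) ((hKne k).image q) (Set.image_mono (hKanti n k hnk))
  obtain ⟨a0, ha0⟩ := hne
  have hdb : BddAbove (Set.range d) := by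
    refine ⟨c * (J a0 + 1) + c', ?_⟩
    rintro _ ⟨n, rfl⟩
    obtain ⟨a, ha⟩ := hKne n
    refine (hdle n a ha).trans ((hco a ha.1).trans ?_)
    have h1 := ha.2 a0 ha0
    have h2 : 1 / ((n:ℝ) + 1) ≤ 1 := by
      rw [div_le_one (by positivity)]; linarith [(Nat.cast_nonneg n : (0:ℝ) ≤ n)]
    have : c * J a ≤ c * (J a0 + 1) := mul_le_mul_of_nonneg_left (by linarith) hc
    linarith
  have hch : ∀ n, ∃ a ∈ K n, q a < d n + 1 / ((n:ℝ) + 1) := by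
    intro n
    obtain ⟨_, ⟨a, ha, rfl⟩, h⟩ := exists_lt_of_csInf_lt ((hKne n).image q)
      (lt_add_of_pos_right (d n) (hpos n))
    exact ⟨a, ha, h⟩
  choose w hwK hwq using hch
  refine ⟨w, fun n => (hwK n).1, fun n => (hwK n).2, fun ε hε => ?_⟩
  have hlim := tendsto_atTop_ciSup hdmono hdb
  have h1 : ∀ᶠ n in atTop, (⨆ i, d i) - ε / 8 < d n :=
    hlim.eventually (lt_mem_nhds (by linarith))
  have h2 : ∀ᶠ n : ℕ in atTop, 1 / ((n:ℝ) + 1) < ε / 8 :=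
    (tendsto_one_div_add_atTop_nhds_zero_nat (𝕜 := ℝ)).eventually (gt_mem_nhds (by linarith))
  obtain ⟨n0, h1, h2⟩ := (h1.and h2).exists
  refine ⟨n0, fun n hn k hk => ?_⟩
  have e1 := hpar (w n) (hwK n).1 (w k) (hwK k).1
  have e2 := hdle n0 _ (hKmid n0 _ (hKanti _ _ hn (hwK n)) _ (hKanti _ _ hk (hwK k)))
  have e3 := hwq n
  have e4 := hwq k
  have e5 := le_ciSup hdb n
  have e6 := le_ciSup hdb k
  have e7 := Nat.one_div_le_one_div (α := ℝ) hn
  have e8 := Nat.one_div_le_one_div (α := ℝ) hk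
  linarith


lemma lim_sm {X : Type*} (ms : MeasurableSpace X) (f : ℕ → X → ℝ)
    (hf : ∀ n, StronglyMeasurable[ms] (f n)) :
    StronglyMeasurable[ms] (fun x => limUnder atTop (fun n => f n x)) :=
  StronglyMeasurable.limUnder hf

section helpers
variable {Ω : Type*} {m : MeasurableSpace Ω} {P : Measure Ω} [IsProbabilityMeasure P]
  {T : ℝ} {𝔽 : Filtration ℝ m}

lemma prog_meas {v : ℝ → Ω → ℝ} (h : IsStronglyProgressive 𝔽 v) :
    Measurable (fun p : ℝ × Ω => v p.1 p.2) := by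
  refine measurable_of_tendsto_metrizable
    (f := fun (n : ℕ) (p : ℝ × Ω) => v (min p.1 n) p.2) ?_ ?_
  · intro n
    have h1 := (h (n : ℝ)).measurable
    have h2 : @Measurable (ℝ × Ω) (Set.Iic (n:ℝ) × Ω) _
        (@Prod.instMeasurableSpace _ _ _ (𝔽 (n:ℝ)))
        (fun p => (⟨min p.1 n, Set.mem_Iic.2 (min_le_right _ _)⟩, p.2)) := by
      refine @Measurable.prodMk _ _ _ (_) (_) (_) _ _ ?_ ?_
      · exact Measurable.subtype_mk (measurable_fst.min measurable_const)
      · exact measurable_snd.mono le_rfl (𝔽.le _)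
    exact h1.comp h2
  · rw [tendsto_pi_nhds]
    intro p
    obtain ⟨k, hk⟩ := exists_nat_ge p.1
    refine tendsto_const_nhds.congr' ?_
    filter_upwards [eventually_ge_atTop k] with n hn
    rw [min_eq_left]
    exact hk.trans (by exact_mod_cast hn)

instance : IsFiniteMeasure (timeProd P T) := by unfold timeProd; infer_instance

lemma memH_iff {v : ℝ → Ω → ℝ} : MemH P T 𝔽 v ↔ IsStronglyProgressive 𝔽 v ∧
    Integrable (fun p : ℝ × Ω => (v p.1 p.2) ^ 2) (timeProd P T) := by
  unfold MemH
  refine and_congr_right fun h => ?_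
  have hm := prog_meas h
  have e : ∫⁻ p, ENNReal.ofReal ((v p.1 p.2) ^ 2) ∂(timeProd P T) =
      ∫⁻ ω, (∫⁻ t in Set.Ioc (0:ℝ) T, ENNReal.ofReal ((v t ω) ^ 2)) ∂P :=
    lintegral_prod_symm' _ (by fun_prop)
  rw [← e]
  constructor
  · intro h
    exact ⟨by fun_prop, (hasFiniteIntegral_iff_ofReal (ae_of_all _ fun p => sq_nonneg _)).2 h⟩
  · intro h
    exact (hasFiniteIntegral_iff_ofReal (ae_of_all _ fun p => sq_nonneg _)).1 h.2

lemma ae_left_of_prod {p : ℝ × Ω → Prop} (h : ∀ᵐ z ∂(timeProd P T), p z) :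
    ∀ᵐ ω ∂P, ∀ᵐ t ∂(volume.restrict (Set.Ioc (0:ℝ) T)), p (t, ω) := by
  unfold timeProd at h
  rw [← Measure.prod_swap] at h
  exact Measure.ae_ae_of_ae_prod (ae_of_ae_map measurable_swap.aemeasurable h)

lemma ae_snd {p : Ω → Prop} (h : ∀ᵐ ω ∂P, p ω) : ∀ᵐ z ∂(timeProd P T), p z.2 :=
  Measure.quasiMeasurePreserving_snd.ae h

lemma ae_fst : ∀ᵐ z ∂(timeProd P T), z.1 ∈ Set.Ioc 0 T :=
  Measure.quasiMeasurePreserving_fst.ae (ae_restrict_mem measurableSet_Ioc)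

lemma int_of_sq {v : ℝ × Ω → ℝ} (hm : Measurable v)
    (h : Integrable (fun p => (v p) ^ 2) (timeProd P T)) : Integrable v (timeProd P T) :=
  ((memLp_two_iff_integrable_sq hm.aestronglyMeasurable).2 h).integrable (by norm_num)

lemma traj_meas {v : ℝ → Ω → ℝ} (hm : Measurable (fun p : ℝ × Ω => v p.1 p.2)) (x0 : ℝ) :
    Measurable (fun p : ℝ × Ω => traj x0 v p.1 p.2) := by
  unfold traj
  have key : ∀ S : Set ((ℝ × Ω) × ℝ), MeasurableSet S →
      Measurable (fun p : ℝ × Ω => ∫ s, S.indicator (fun q => v q.2 q.1.2) (p, s)) := by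
    intro S hS
    have : Measurable (fun q : (ℝ × Ω) × ℝ => v q.2 q.1.2) :=
      hm.comp (measurable_snd.prodMk (measurable_snd.comp measurable_fst))
    exact ((this.indicator hS).stronglyMeasurable.integral_prod_right').measurable
  have hA : MeasurableSet {q : (ℝ × Ω) × ℝ | 0 < q.2 ∧ q.2 ≤ q.1.1} :=
    (measurableSet_lt measurable_const measurable_snd).inter
      (measurableSet_le measurable_snd (by fun_prop))
  have hB : MeasurableSet {q : (ℝ × Ω) × ℝ | q.1.1 < q.2 ∧ q.2 ≤ 0} :=
    (measurableSet_lt (by fun_prop) measurable_snd).inter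
      (measurableSet_le measurable_snd measurable_const)
  refine measurable_const.add ?_
  have e : (fun p : ℝ × Ω => ∫ s in (0:ℝ)..p.1, v s p.2) = fun p =>
     (∫ s, Set.indicator {q : (ℝ × Ω) × ℝ | 0 < q.2 ∧ q.2 ≤ q.1.1} (fun q => v q.2 q.1.2) (p, s))
     - ∫ s, Set.indicator {q : (ℝ × Ω) × ℝ | q.1.1 < q.2 ∧ q.2 ≤ 0} (fun q => v q.2 q.1.2) (p, s) := by
    funext p
    rw [intervalIntegral, ← integral_indicator measurableSet_Ioc,
      ← integral_indicator measurableSet_Ioc]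
    rfl
  rw [e]
  exact (key _ hA).sub (key _ hB)

lemma cs_bound {f : ℝ → ℝ} (hT : 0 < T)
    (h1 : Integrable f (volume.restrict (Set.Ioc (0:ℝ) T)))
    (h2 : Integrable (fun t => f t ^ 2) (volume.restrict (Set.Ioc (0:ℝ) T))) :
    (∫ t in (0:ℝ)..T, f t) ^ 2 ≤ T * ∫ t in Set.Ioc (0:ℝ) T, f t ^ 2 := by
  rw [intervalIntegral.integral_of_le hT.le]
  set I := ∫ t in Set.Ioc (0:ℝ) T, f t with hI
  have h0 : 0 ≤ ∫ t in Set.Ioc (0:ℝ) T, (f t - I / T) ^ 2 := integral_nonneg fun t => sq_nonneg _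
  have e : ∫ t in Set.Ioc (0:ℝ) T, (f t - I / T) ^ 2
      = (∫ t in Set.Ioc (0:ℝ) T, f t ^ 2) - 2 * (I / T) * I + (I / T) ^ 2 * T := by
    have : ∀ t, (f t - I / T) ^ 2 = (f t ^ 2 - 2 * (I / T) * f t) + (I / T) ^ 2 := fun t => by ring
    simp_rw [this]
    have h3 : Integrable (fun t => f t ^ 2 - 2 * (I / T) * f t)
      (volume.restrict (Set.Ioc (0:ℝ) T)) := h2.sub (h1.const_mul _)
    rw [integral_add h3 (integrable_const _), integral_sub h2 (h1.const_mul _), integral_const_mul]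
    rw [← hI]
    simp [hT.le, mul_comm]
  rw [e] at h0
  have : T * ((∫ t in Set.Ioc (0:ℝ) T, f t ^ 2) - 2 * (I / T) * I + (I / T) ^ 2 * T)
    = T * (∫ t in Set.Ioc (0:ℝ) T, f t ^ 2) - I ^ 2 := by field_simp; ring
  nlinarith [mul_nonneg hT.le h0]

/-- integrand combining running and terminal cost -/
def gfun (T : ℝ) (L : ℝ → ℝ → ℝ) (Ψ : ℝ → ℝ) (x0 : ℝ) (v : ℝ → Ω → ℝ) (p : ℝ × Ω) : ℝ :=
  L (traj x0 v p.1 p.2) (v p.1 p.2) + Ψ (traj x0 v T p.2) / T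

variable {L : ℝ → ℝ → ℝ} {Ψ : ℝ → ℝ}

lemma L_int (hL : Continuous (Function.uncurry L))
    (hL0 : ∀ x v, 0 ≤ L x v)
    (hL_growth : ∃ β > (0:ℝ), ∀ x v, L x v ≤ β * (1 + |v| ^ 2))
    {v : ℝ → Ω → ℝ} (hv : MemH P T 𝔽 v) (x0 : ℝ) :
    Integrable (fun p : ℝ × Ω => L (traj x0 v p.1 p.2) (v p.1 p.2)) (timeProd P T) := by
  obtain ⟨hp, h2⟩ := memH_iff.1 hv
  have hm := prog_meas hp
  obtain ⟨b, hb, hb'⟩ := hL_growth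
  refine Integrable.mono' (((integrable_const (1:ℝ)).add h2).const_mul b) ?_ (ae_of_all _ ?_)
  · exact (hL.measurable.comp ((traj_meas hm x0).prodMk hm)).aestronglyMeasurable
  · intro p
    rw [Real.norm_of_nonneg (hL0 _ _)]
    simpa using hb' (traj x0 v p.1 p.2) (v p.1 p.2)

lemma psi_int (hT : 0 < T) (hΨ : Continuous Ψ)
    (hΨ0 : ∀ x, 0 ≤ Ψ x)
    (hΨ_growth : ∃ C > (0:ℝ), ∀ x, Ψ x ≤ C * (1 + |x| ^ 2))
    {v : ℝ → Ω → ℝ} (hv : MemH P T 𝔽 v) (x0 : ℝ) :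
    Integrable (fun ω => Ψ (traj x0 v T ω)) P := by
  obtain ⟨hp, h2⟩ := memH_iff.1 hv
  have hm := prog_meas hp
  have h1 := int_of_sq hm h2
  obtain ⟨C, hC, hC'⟩ := hΨ_growth
  have hI : Integrable (fun ω => ∫ t in Set.Ioc (0:ℝ) T, (v t ω) ^ 2) P := h2.integral_prod_right
  refine Integrable.mono' (((integrable_const (1 + 2 * x0 ^ 2:ℝ)).add
    (hI.const_mul (2 * T))).const_mul C) ?_ ?_
  · exact (hΨ.measurable.comp ((traj_meas hm x0).comp
      (measurable_const.prodMk measurable_id))).aestronglyMeasurable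
  · filter_upwards [h1.prod_left_ae, h2.prod_left_ae] with ω a1 a2
    rw [Real.norm_of_nonneg (hΨ0 _)]
    refine (hC' _).trans (mul_le_mul_of_nonneg_left ?_ hC.le)
    have := cs_bound hT a1 a2
    simp only [traj, sq_abs, Pi.add_apply]
    nlinarith [sq_nonneg (x0 - ∫ t in (0:ℝ)..T, v t ω)]

lemma g_int (hT : 0 < T) (hL : Continuous (Function.uncurry L))
    (hL0 : ∀ x v, 0 ≤ L x v)
    (hL_growth : ∃ β > (0:ℝ), ∀ x v, L x v ≤ β * (1 + |v| ^ 2)) (hΨ : Continuous Ψ)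
    (hΨ0 : ∀ x, 0 ≤ Ψ x)
    (hΨ_growth : ∃ C > (0:ℝ), ∀ x, Ψ x ≤ C * (1 + |x| ^ 2))
    {v : ℝ → Ω → ℝ} (hv : MemH P T 𝔽 v) (x0 : ℝ) :
    Integrable (gfun T L Ψ x0 v) (timeProd P T) :=
  (L_int hL hL0 hL_growth hv x0).add
    (((psi_int hT hΨ hΨ0 hΨ_growth hv x0).div_const T).comp_snd _)

lemma g_cost (hT : 0 < T) (hL : Continuous (Function.uncurry L))
    (hL0 : ∀ x v, 0 ≤ L x v)
    (hL_growth : ∃ β > (0:ℝ), ∀ x v, L x v ≤ β * (1 + |v| ^ 2)) (hΨ : Continuous Ψ)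
    (hΨ0 : ∀ x, 0 ≤ Ψ x)
    (hΨ_growth : ∃ C > (0:ℝ), ∀ x, Ψ x ≤ C * (1 + |x| ^ 2))
    {v : ℝ → Ω → ℝ} (hv : MemH P T 𝔽 v) (x0 : ℝ) :
    ∫ ω, ((∫ t in Set.Ioc (0:ℝ) T,
      L (traj x0 v t ω) (v t ω)) + Ψ (traj x0 v T ω)) ∂P =
    ∫ p, gfun T L Ψ x0 v p ∂(timeProd P T) := by
  have hg := g_int hT hL hL0 hL_growth hΨ hΨ0 hΨ_growth hv x0
  have hl := L_int hL hL0 hL_growth hv x0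
  have e : ∫ p, gfun T L Ψ x0 v p ∂(timeProd P T) =
    ∫ ω, (∫ t in Set.Ioc (0:ℝ) T, gfun T L Ψ x0 v (t, ω)) ∂P := integral_prod_symm _ hg
  rw [e]
  refine integral_congr_ae ?_
  filter_upwards [hl.prod_left_ae] with ω h
  simp only [gfun]
  rw [integral_add h (integrable_const _)]
  simp [hT.le]
  field_simp

lemma traj_mid {u v : ℝ → Ω → ℝ} {ω : Ω} {t : ℝ} (ht : t ∈ Set.Icc 0 T) (x0 : ℝ)
    (hu : Integrable (fun t => u t ω) (volume.restrict (Set.Ioc (0:ℝ) T)))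
    (hv : Integrable (fun t => v t ω) (volume.restrict (Set.Ioc (0:ℝ) T))) :
    traj x0 (fun t ω => (u t ω + v t ω) / 2) t ω = (traj x0 u t ω + traj x0 v t ω) / 2 := by
  have hs : Set.Ioc 0 t ⊆ Set.Ioc 0 T := Set.Ioc_subset_Ioc_right ht.2
  have hu' : IntervalIntegrable (fun t => u t ω) volume 0 t :=
    (intervalIntegrable_iff_integrableOn_Ioc_of_le ht.1).2 (IntegrableOn.mono_set hu hs)
  have hv' : IntervalIntegrable (fun t => v t ω) volume 0 t :=
    (intervalIntegrable_iff_integrableOn_Ioc_of_le ht.1).2 (IntegrableOn.mono_set hv hs)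
  unfold traj
  rw [intervalIntegral.integral_div, intervalIntegral.integral_add hu' hv']
  ring

lemma g_mid (hT : 0 < T) (hL : ConvexOn ℝ Set.univ (Function.uncurry L))
    (hΨ : ConvexOn ℝ Set.univ Ψ) {u v : ℝ → Ω → ℝ} (hu : MemH P T 𝔽 u) (hv : MemH P T 𝔽 v)
    (x0 : ℝ) : ∀ᵐ p ∂(timeProd P T), gfun T L Ψ x0 (fun t ω => (u t ω + v t ω) / 2) p ≤
      (gfun T L Ψ x0 u p + gfun T L Ψ x0 v p) / 2 := by
  obtain ⟨hp, h2⟩ := memH_iff.1 hu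
  have h1 := int_of_sq (prog_meas hp) h2
  obtain ⟨hp', h2'⟩ := memH_iff.1 hv
  have h1' := int_of_sq (prog_meas hp') h2'
  filter_upwards [ae_snd h1.prod_left_ae, ae_snd h1'.prod_left_ae, ae_fst] with p a1 a2 a3
  unfold gfun
  rw [traj_mid ⟨a3.1.le, a3.2⟩ x0 a1 a2, traj_mid ⟨hT.le, le_rfl⟩ x0 a1 a2]
  have c1 := hL.2 (Set.mem_univ (traj x0 u p.1 p.2, u p.1 p.2))
    (Set.mem_univ (traj x0 v p.1 p.2, v p.1 p.2)) (by norm_num : (0:ℝ) ≤ 1/2)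
    (by norm_num : (0:ℝ) ≤ 1/2) (by norm_num)
  have c2 := hΨ.2 (Set.mem_univ (traj x0 u T p.2)) (Set.mem_univ (traj x0 v T p.2))
    (by norm_num : (0:ℝ) ≤ 1/2) (by norm_num : (0:ℝ) ≤ 1/2) (by norm_num)
  simp only [Function.uncurry, Prod.smul_mk, Prod.mk_add_mk, smul_eq_mul] at c1 c2
  have e : ∀ a b : ℝ, (a + b) / 2 = 1 / 2 * a + 1 / 2 * b := fun a b => by ring
  beta_reduce
  rw [e (traj x0 u p.1 p.2), e (u p.1 p.2), e (traj x0 u T p.2)]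
  have c3 := div_le_div_of_nonneg_right c2 hT.le
  calc _ ≤ _ := add_le_add c1 c3
    _ = _ := by ring

lemma traj_lim {u : ℕ → ℝ → Ω → ℝ} {v : ℝ → Ω → ℝ} (hu : ∀ n, MemH P T 𝔽 (u n))
    (hv : MemH P T 𝔽 v) (x0 : ℝ)
    (hs : ∑' n, ∫⁻ p, ‖u n p.1 p.2 - v p.1 p.2‖ₑ ∂(timeProd P T) ≠ ⊤) :
    ∀ᵐ ω ∂P, ∀ t ∈ Set.Icc 0 T,
      Tendsto (fun n => traj x0 (u n) t ω) atTop (𝓝 (traj x0 v t ω)) := by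
  have hmu := fun n => prog_meas (memH_iff.1 (hu n)).1
  have hmv := prog_meas (memH_iff.1 hv).1
  have hiu := fun n => int_of_sq (hmu n) (memH_iff.1 (hu n)).2
  have hiv := int_of_sq hmv (memH_iff.1 hv).2
  have hme : ∀ n, Measurable (fun p : ℝ × Ω => ‖u n p.1 p.2 - v p.1 p.2‖ₑ) :=
    fun n => ((hmu n).sub hmv).enorm
  have e : ∀ n, ∫⁻ p, ‖u n p.1 p.2 - v p.1 p.2‖ₑ ∂(timeProd P T) =
      ∫⁻ ω, (∫⁻ t in Set.Ioc (0:ℝ) T, ‖u n t ω - v t ω‖ₑ) ∂P :=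
    fun n => lintegral_prod_symm' _ (hme n)
  simp_rw [e] at hs
  have hme2 : ∀ n, Measurable (fun ω => ∫⁻ t in Set.Ioc (0:ℝ) T, ‖u n t ω - v t ω‖ₑ) :=
    fun n => (hme n).lintegral_prod_left'
  rw [← lintegral_tsum (fun n => (hme2 n).aemeasurable)] at hs
  have hfin := ae_lt_top (Measurable.tsum hme2) hs
  have hall : ∀ᵐ ω ∂P, ∀ n, Integrable (fun t => u n t ω) (volume.restrict (Set.Ioc (0:ℝ) T)) :=
    ae_all_iff.2 fun n => (hiu n).prod_left_ae
  filter_upwards [hfin, hall, hiv.prod_left_ae] with ω h1 h2 h3 t ht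
  have h4 := ENNReal.tendsto_atTop_zero_of_tsum_ne_top h1.ne
  have hst : Set.Ioc 0 t ⊆ Set.Ioc 0 T := Set.Ioc_subset_Ioc_right ht.2
  unfold traj
  refine tendsto_const_nhds.add ?_
  rw [tendsto_iff_edist_tendsto_0]
  refine tendsto_of_tendsto_of_tendsto_of_le_of_le tendsto_const_nhds h4 (fun _ => zero_le) ?_
  intro n
  simp only
  rw [edist_eq_enorm_sub, intervalIntegral.integral_of_le ht.1, intervalIntegral.integral_of_le ht.1,
    ← integral_sub (IntegrableOn.mono_set (h2 n) hst) (IntegrableOn.mono_set h3 hst)]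
  exact (enorm_integral_le_lintegral_enorm _).trans (lintegral_mono_set hst)


lemma memH_complete {u : ℕ → ℝ → Ω → ℝ} (hu : ∀ n, MemH P T 𝔽 (u n))
    (hc : ∀ M n k : ℕ, M ≤ n → M ≤ k →
      ∫ p, (u n p.1 p.2 - u k p.1 p.2) ^ 2 ∂(timeProd P T) ≤ (1 / 4) ^ (M + 1)) :
    ∃ v : ℝ → Ω → ℝ, MemH P T 𝔽 v ∧
      (∀ᵐ p ∂(timeProd P T), Tendsto (fun n => u n p.1 p.2) atTop (𝓝 (v p.1 p.2))) ∧
      ∑' n, ∫⁻ p, ‖u n p.1 p.2 - v p.1 p.2‖ₑ ∂(timeProd P T) ≠ ⊤ := by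
  set f : ℕ → ℝ × Ω → ℝ := fun n p => u n p.1 p.2 with hf
  have hmu : ∀ n, Measurable (f n) := fun n => prog_meas (memH_iff.1 (hu n)).1
  have hL2 : ∀ n, MemLp (f n) 2 (timeProd P T) := fun n =>
    (memLp_two_iff_integrable_sq (hmu n).aestronglyMeasurable).2 (memH_iff.1 (hu n)).2
  set B : ℕ → ENNReal := fun n => ENNReal.ofReal ((1 / 2) ^ n) with hB
  have hBs : ∑' n, B n ≠ ⊤ := summable_geometric_two.tsum_ofReal_ne_top
  have h_cau : ∀ M n k : ℕ, M ≤ n → M ≤ k → eLpNorm (f n - f k) 2 (timeProd P T) < B M := by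
    intro M n k hn hk
    rw [((hL2 n).sub (hL2 k)).eLpNorm_eq_integral_rpow_norm (by norm_num) (by norm_num)]
    refine (ENNReal.ofReal_lt_ofReal_iff (by positivity)).2 ?_
    have h1 := hc M n k hn hk
    have e : ∫ p, ‖(f n - f k) p‖ ^ (2:ENNReal).toReal ∂(timeProd P T)
        = ∫ p, (u n p.1 p.2 - u k p.1 p.2) ^ 2 ∂(timeProd P T) := by
      refine integral_congr_ae (ae_of_all _ fun p => ?_)
      simp [hf]
    rw [e]
    have h0 : 0 ≤ ∫ p, (u n p.1 p.2 - u k p.1 p.2) ^ 2 ∂(timeProd P T) :=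
      integral_nonneg fun p => sq_nonneg _
    have : (2:ENNReal).toReal⁻¹ = 1 / 2 := by simp
    rw [this, ← Real.sqrt_eq_rpow]
    calc _ ≤ Real.sqrt ((1 / 4) ^ (M + 1)) := Real.sqrt_le_sqrt h1
      _ = (1 / 2) ^ (M + 1) := by
        rw [Real.sqrt_eq_iff_mul_self_eq (by positivity) (by positivity), ← mul_pow]; norm_num
      _ < (1 / 2) ^ M := by rw [pow_succ]; linarith [pow_pos (by norm_num : (0:ℝ) < 1/2) M]
  have hfm := fun n => (hmu n).aestronglyMeasurable (μ := timeProd P T)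
  have hlim := Lp.ae_tendsto_of_cauchy_eLpNorm hfm (by norm_num) hBs h_cau
  set v : ℝ → Ω → ℝ := fun t ω => limUnder atTop (fun n => u n t ω) with hv
  set g : ℝ × Ω → ℝ := fun p => v p.1 p.2 with hg
  have hlim' : ∀ᵐ p ∂(timeProd P T), Tendsto (fun n => f n p) atTop (𝓝 (g p)) := by
    filter_upwards [hlim] with p hp
    exact tendsto_nhds_limUnder hp
  have hprog : IsStronglyProgressive 𝔽 v := fun i =>
    lim_sm _ (fun n (p : Set.Iic i × Ω) => u n p.1 p.2) (fun n => (memH_iff.1 (hu n)).1 i)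
  have hgm : Measurable g := prog_meas hprog
  have htend := Lp.cauchy_tendsto_of_tendsto hfm g hBs h_cau hlim'
  have hgL := Lp.memLp_of_cauchy_tendsto (by norm_num) hL2 g hgm.aestronglyMeasurable htend
  refine ⟨v, memH_iff.2 ⟨hprog,
    (memLp_two_iff_integrable_sq hgm.aestronglyMeasurable).1 hgL⟩, hlim', ?_⟩
  have hb : ∀ n, eLpNorm (f n - g) 2 (timeProd P T) ≤ B n := by
    intro n
    refine (Lp.eLpNorm_lim_le_liminf_eLpNorm (f := fun k => f n - f k)
      (fun k => (hfm n).sub (hfm k)) (f n - g) ?_).trans ?_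
    · filter_upwards [hlim'] with p hp
      exact tendsto_const_nhds.sub hp
    · refine liminf_le_of_frequently_le' (Eventually.frequently ?_)
      filter_upwards [eventually_ge_atTop n] with k hk
      exact (h_cau n n k le_rfl hk).le
  set c := (timeProd P T) Set.univ ^ (1 / (1:ENNReal).toReal - 1 / (2:ENNReal).toReal) with hcdef
  have hc' : c ≠ ⊤ := by
    refine ENNReal.rpow_ne_top_of_nonneg ?_ (measure_ne_top _ _)
    norm_num
  refine ne_top_of_le_ne_top (ENNReal.mul_ne_top hBs hc') ?_
  rw [← ENNReal.tsum_mul_right]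
  refine ENNReal.tsum_le_tsum fun n => ?_
  have := eLpNorm_le_eLpNorm_mul_rpow_measure_univ (p := 1) (q := 2) (by norm_num)
    ((hfm n).sub hgm.aestronglyMeasurable)
  rw [eLpNorm_one_eq_lintegral_enorm] at this
  exact this.trans (mul_le_mul_left (hb n) c)

lemma memH_mid {u v : ℝ → Ω → ℝ} (hu : MemH P T 𝔽 u) (hv : MemH P T 𝔽 v) :
    MemH P T 𝔽 (fun t ω => (u t ω + v t ω) / 2) := by
  obtain ⟨hp, h2⟩ := memH_iff.1 hu
  obtain ⟨hp', h2'⟩ := memH_iff.1 hv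
  refine memH_iff.2 ⟨fun i => ?_, ?_⟩
  · have := ((hp i).add (hp' i)).mul_const (2⁻¹:ℝ)
    simpa [div_eq_mul_inv] using this
  · have hm := prog_meas hp
    have hm' := prog_meas hp'
    refine Integrable.mono' (h2.add h2') (by fun_prop) (ae_of_all _ fun p => ?_)
    rw [Real.norm_of_nonneg (sq_nonneg _)]
    simp only [Pi.add_apply]
    nlinarith [sq_nonneg (u p.1 p.2 - v p.1 p.2), sq_nonneg (u p.1 p.2), sq_nonneg (v p.1 p.2)]

lemma memH_par {u v : ℝ → Ω → ℝ} (hu : MemH P T 𝔽 u) (hv : MemH P T 𝔽 v) :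
    ∫ p, (u p.1 p.2 - v p.1 p.2) ^ 2 ∂(timeProd P T) +
      4 * ∫ p, ((u p.1 p.2 + v p.1 p.2) / 2) ^ 2 ∂(timeProd P T) =
    2 * ∫ p, (u p.1 p.2) ^ 2 ∂(timeProd P T) + 2 * ∫ p, (v p.1 p.2) ^ 2 ∂(timeProd P T) := by
  have h1 := (memH_iff.1 hu).2
  have h2 := (memH_iff.1 hv).2
  have h3 := (memH_iff.1 (memH_mid hu hv)).2
  have e : ∀ p : ℝ × Ω, (u p.1 p.2 - v p.1 p.2) ^ 2 = (2 * (u p.1 p.2) ^ 2 + 2 * (v p.1 p.2) ^ 2)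
      - 4 * ((u p.1 p.2 + v p.1 p.2) / 2) ^ 2 := fun p => by ring
  have h4 : Integrable (fun p : ℝ × Ω => 2 * (u p.1 p.2) ^ 2 + 2 * (v p.1 p.2) ^ 2)
    (timeProd P T) := (h1.const_mul 2).add (h2.const_mul 2)
  simp_rw [e]
  rw [integral_sub h4 (h3.const_mul 4), integral_add (h1.const_mul 2) (h2.const_mul 2),
    integral_const_mul, integral_const_mul, integral_const_mul]
  ring

end helpers


theorem exists_optimal_control_N_agent
    {Ω : Type*} {m : MeasurableSpace Ω} (P : Measure Ω) [IsProbabilityMeasure P]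
    (T : ℝ) (hT : 0 < T) (𝔽 : Filtration ℝ m)
    (L : ℝ → ℝ → ℝ) (Ψ : ℝ → ℝ)
    -- (A1): L ∈ C¹, nonnegative, jointly convex
    (hL_C1 : ContDiff ℝ 1 (Function.uncurry L))
    (hL_nonneg : ∀ x v, 0 ≤ L x v)
    (hL_convex : ConvexOn ℝ Set.univ (Function.uncurry L))
    -- (A2): Ψ ∈ C¹, nonnegative, convex
    (hΨ_C1 : ContDiff ℝ 1 Ψ)
    (hΨ_nonneg : ∀ x, 0 ≤ Ψ x)
    (hΨ_convex : ConvexOn ℝ Set.univ Ψ)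
    -- (A3): growth of Ψ and Ψ'
    (hΨ_growth : ∃ C > (0:ℝ), ∀ x, Ψ x ≤ C * (1 + |x| ^ 2))
    (hΨ'_growth : ∃ C > (0:ℝ), ∀ x, |deriv Ψ x| ≤ C * (1 + |x|))
    -- (A4): growth of L, L_x, L_v
    (hL_growth : ∃ β > (0:ℝ), ∀ x v, L x v ≤ β * (1 + |v| ^ 2))
    (hL_deriv_growth : ∃ C > (0:ℝ), ∀ x v,
      |deriv (fun y => L y v) x| ≤ C * (1 + |v|) ∧
      |deriv (fun w => L x w) v| ≤ C * (1 + |v|))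
    -- (A5): coercivity of L
    (α β : ℝ) (hα : 0 < α) (hβ : 0 ≤ β)
    (hL_coercive : ∀ x v, α * |v| ^ 2 - β ≤ L x v)
    (N : ℕ) (hN : 0 < N) (x0 : Fin N → ℝ)
    (Q : ℝ → Ω → ℝ) (hQ : MemH P T 𝔽 Q) :
    ∃ vstar : Fin N → ℝ → Ω → ℝ,
      (∀ i, MemH P T 𝔽 (vstar i)) ∧ Balance P T N vstar Q ∧
        ∀ v : Fin N → ℝ → Ω → ℝ, (∀ i, MemH P T 𝔽 (v i)) → Balance P T N v Q →
          costN P T L Ψ N x0 vstar ≤ costN P T L Ψ N x0 v := by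
  have hLc := hL_C1.continuous
  have hΨc := hΨ_C1.continuous
  have hNR : (0:ℝ) < N := by exact_mod_cast hN
  have hgi : ∀ i, ∀ v, MemH P T 𝔽 v → Integrable (gfun T L Ψ (x0 i) v) (timeProd P T) :=
    fun i v hv => g_int hT hLc hL_nonneg hL_growth hΨc hΨ_nonneg hΨ_growth hv (x0 i)
  have hg0 : ∀ i v p, 0 ≤ gfun (Ω := Ω) T L Ψ (x0 i) v p := fun i v p =>
    add_nonneg (hL_nonneg _ _) (div_nonneg (hΨ_nonneg _) hT.le)
  set A : Set (Fin N → ℝ → Ω → ℝ) := {v | (∀ i, MemH P T 𝔽 (v i)) ∧ Balance P T N v Q} with hA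
  set J : (Fin N → ℝ → Ω → ℝ) → ℝ := fun v =>
    ∫ p, ∑ i, gfun T L Ψ (x0 i) (v i) p ∂(timeProd P T) with hJ
  have hcost : ∀ v : Fin N → ℝ → Ω → ℝ, (∀ i, MemH P T 𝔽 (v i)) →
      costN P T L Ψ N x0 v = (1 / (N:ℝ)) * J v := by
    intro v hv
    unfold costN
    rw [hJ]
    simp only
    rw [integral_finsetSum _ (fun i _ => hgi i _ (hv i))]
    congr 1
    exact Finset.sum_congr rfl fun i _ =>
      g_cost hT hLc hL_nonneg hL_growth hΨc hΨ_nonneg hΨ_growth (hv i) (x0 i)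
  have hGi : ∀ v : Fin N → ℝ → Ω → ℝ, (∀ i, MemH P T 𝔽 (v i)) →
      Integrable (fun p => ∑ i, gfun T L Ψ (x0 i) (v i) p) (timeProd P T) :=
    fun v hv => integrable_finsetSum _ (fun i _ => hgi i _ (hv i))
  have hGn : ∀ (v : Fin N → ℝ → Ω → ℝ) p, 0 ≤ ∑ i, gfun T L Ψ (x0 i) (v i) p :=
    fun v p => Finset.sum_nonneg fun i _ => hg0 i _ p
  have hJ0 : ∀ v, 0 ≤ J v := fun v => integral_nonneg (hGn v)
  obtain ⟨w, hwA, hwJ, hwD⟩ := absmin A ⟨fun _ => Q, fun _ => hQ, by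
      refine ae_of_all _ fun p => ?_
      simp [hNR.ne']⟩
    (fun u v i t ω => (u i t ω + v i t ω) / 2) J
    (fun v => ∑ i, ∫ p, (v i p.1 p.2) ^ 2 ∂(timeProd P T))
    (fun u v => ∑ i, ∫ p, (u i p.1 p.2 - v i p.1 p.2) ^ 2 ∂(timeProd P T))
    (1 / α) ((timeProd P T).real Set.univ * (N * β) / α)
    (by
      rintro u ⟨hu, hub⟩ v ⟨hv, hvb⟩
      refine ⟨fun i => memH_mid (hu i) (hv i), ?_⟩
      unfold Balance at *
      filter_upwards [hub, hvb] with p h1 h2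
      rw [← Finset.sum_div, Finset.sum_add_distrib]
      linarith)
    hJ0 (by positivity)
    (by
      rintro u ⟨hu, hub⟩ v ⟨hv, hvb⟩
      have hm : ∀ i, MemH P T 𝔽 (fun t ω => (u i t ω + v i t ω) / 2) :=
        fun i => memH_mid (hu i) (hv i)
      have hall : ∀ᵐ p ∂(timeProd P T), ∀ i,
          gfun T L Ψ (x0 i) (fun t ω => (u i t ω + v i t ω) / 2) p ≤
          (gfun T L Ψ (x0 i) (u i) p + gfun T L Ψ (x0 i) (v i) p) / 2 :=
        ae_all_iff.2 fun i => g_mid hT hL_convex hΨ_convex (hu i) (hv i) (x0 i)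
      have e : (J u + J v) / 2 = ∫ p, (∑ i, gfun T L Ψ (x0 i) (u i) p +
          ∑ i, gfun T L Ψ (x0 i) (v i) p) / 2 ∂(timeProd P T) := by
        rw [integral_div, integral_add (hGi u hu) (hGi v hv)]
      rw [e]
      refine integral_mono_ae (hGi _ hm) (((hGi u hu).add (hGi v hv)).div_const 2) ?_
      filter_upwards [hall] with p hp
      beta_reduce
      rw [← Finset.sum_add_distrib, Finset.sum_div]
      exact Finset.sum_le_sum fun i _ => hp i)
    (fun v => Finset.sum_nonneg fun i _ => integral_nonneg fun p => sq_nonneg _)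
    (by
      rintro u ⟨hu, hub⟩ v ⟨hv, hvb⟩
      simp only [Finset.mul_sum]
      rw [← Finset.sum_add_distrib, ← Finset.sum_add_distrib]
      exact Finset.sum_congr rfl fun i _ => memH_par (hu i) (hv i))
    (by
      rintro u ⟨hu, hub⟩
      have h1 : ∫ p, (α * ∑ i, (u i p.1 p.2) ^ 2 - N * β) ∂(timeProd P T) ≤ J u := by
        refine integral_mono ?_ (hGi u hu) ?_
        · exact ((integrable_finsetSum _ fun i _ => (memH_iff.1 (hu i)).2).const_mul α).sub
            (integrable_const _)
        · intro p
          have : α * ∑ i, (u i p.1 p.2) ^ 2 - N * β = ∑ i, (α * (u i p.1 p.2) ^ 2 - β) := by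
            rw [Finset.sum_sub_distrib, Finset.mul_sum]; simp
          beta_reduce
          rw [this]
          refine Finset.sum_le_sum fun i _ => ?_
          have h3 := hL_coercive (traj (x0 i) (u i) p.1 p.2) (u i p.1 p.2)
          rw [sq_abs] at h3
          exact h3.trans (le_add_of_nonneg_right (div_nonneg (hΨ_nonneg _) hT.le))
      rw [integral_sub ((integrable_finsetSum _ fun i _ => (memH_iff.1 (hu i)).2).const_mul α)
        (integrable_const _), integral_const_mul,
        integral_finsetSum _ fun i _ => (memH_iff.1 (hu i)).2, integral_const, smul_eq_mul] at h1
      rw [one_div, inv_mul_eq_div, ← add_div, le_div_iff₀ hα]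
      linarith)
  -- subsequence
  have hev : ∀ n : ℕ, ∃ M, ∀ a ≥ M, ∀ l ≥ a, ∀ k ≥ a,
      ∑ i, ∫ p, (w l i p.1 p.2 - w k i p.1 p.2) ^ 2 ∂(timeProd P T) ≤ (1 / 4) ^ (n + 1) := by
    intro n
    obtain ⟨M, hM⟩ := hwD ((1 / 4) ^ (n + 1)) (by positivity)
    exact ⟨M, fun a ha l hl k hk => hM l (le_trans ha hl) k (le_trans ha hk)⟩
  obtain ⟨φ, hφ, hφD⟩ := extraction_forall_of_eventually' hev
  have hcomp : ∀ i, ∃ v : ℝ → Ω → ℝ, MemH P T 𝔽 v ∧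
      (∀ᵐ p ∂(timeProd P T), Tendsto (fun n => w (φ n) i p.1 p.2) atTop (𝓝 (v p.1 p.2))) ∧
      ∑' n, ∫⁻ p, ‖w (φ n) i p.1 p.2 - v p.1 p.2‖ₑ ∂(timeProd P T) ≠ ⊤ := by
    intro i
    refine memH_complete (u := fun n => w (φ n) i) (fun n => (hwA (φ n)).1 i) ?_
    intro M n k hn hk
    refine le_trans ?_ (hφD M (φ n) (hφ.monotone hn) (φ k) (hφ.monotone hk))
    exact Finset.single_le_sum
      (f := fun i => ∫ p, (w (φ n) i p.1 p.2 - w (φ k) i p.1 p.2) ^ 2 ∂(timeProd P T))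
      (fun j _ => integral_nonneg fun p => sq_nonneg _) (Finset.mem_univ i)
  choose v hvH hvlim hvs using hcomp
  have hvlim' := ae_all_iff.2 hvlim
  refine ⟨v, hvH, ?_, ?_⟩
  · have hall : ∀ᵐ p ∂(timeProd P T), ∀ n, (1 / (N:ℝ)) * ∑ i, w (φ n) i p.1 p.2 = Q p.1 p.2 :=
      ae_all_iff.2 fun n => (hwA (φ n)).2
    unfold Balance
    filter_upwards [hall, hvlim'] with p h1 h2
    have h3 : Tendsto (fun n => (1 / (N:ℝ)) * ∑ i, w (φ n) i p.1 p.2) atTop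
        (𝓝 ((1 / (N:ℝ)) * ∑ i, v i p.1 p.2)) :=
      (tendsto_finsetSum _ fun i _ => h2 i).const_mul _
    simp_rw [h1] at h3
    exact tendsto_nhds_unique h3 tendsto_const_nhds
  · intro u hu hub
    rw [hcost v hvH, hcost u hu]
    refine mul_le_mul_of_nonneg_left ?_ (by positivity)
    have htr : ∀ᵐ p ∂(timeProd P T), ∀ i, ∀ t ∈ Set.Icc 0 T,
        Tendsto (fun n => traj (x0 i) (w (φ n) i) t p.2) atTop (𝓝 (traj (x0 i) (v i) t p.2)) :=
      ae_all_iff.2 fun i => ae_snd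
        (traj_lim (u := fun n => w (φ n) i) (fun n => (hwA (φ n)).1 i) (hvH i) (x0 i) (hvs i))
    have hG : ∀ᵐ p ∂(timeProd P T), Tendsto
        (fun n => ENNReal.ofReal (∑ i, gfun T L Ψ (x0 i) (w (φ n) i) p)) atTop
        (𝓝 (ENNReal.ofReal (∑ i, gfun T L Ψ (x0 i) (v i) p))) := by
      filter_upwards [hvlim', htr, ae_fst] with p h1 h2 h3
      refine ENNReal.tendsto_ofReal (tendsto_finsetSum _ fun i _ => ?_)
      unfold gfun
      refine Tendsto.add ?_ (((hΨc.tendsto _).comp (h2 i T ⟨hT.le, le_rfl⟩)).div_const T)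
      exact (hLc.tendsto (traj (x0 i) (v i) p.1 p.2, v i p.1 p.2)).comp
        ((h2 i p.1 ⟨h3.1.le, h3.2⟩).prodMk_nhds (h1 i))
    have hfat : ENNReal.ofReal (J v) ≤ ENNReal.ofReal (J u) := by
      rw [hJ]
      simp only
      rw [ofReal_integral_eq_lintegral_ofReal (hGi v hvH) (ae_of_all _ (hGn v))]
      calc _ = ∫⁻ p, liminf (fun n => ENNReal.ofReal (∑ i, gfun T L Ψ (x0 i) (w (φ n) i) p)) atTop
              ∂(timeProd P T) :=
            lintegral_congr_ae (hG.mono fun p hp => hp.liminf_eq.symm)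
        _ ≤ liminf (fun n => ∫⁻ p, ENNReal.ofReal (∑ i, gfun T L Ψ (x0 i) (w (φ n) i) p)
              ∂(timeProd P T)) atTop :=
            lintegral_liminf_le' fun n =>
              (hGi _ (hwA (φ n)).1).aestronglyMeasurable.aemeasurable.ennreal_ofReal
        _ ≤ liminf (fun n : ℕ => ENNReal.ofReal (J u + 1 / ((n:ℝ) + 1))) atTop := by
            refine liminf_le_liminf (Eventually.of_forall fun n => ?_)
            rw [← ofReal_integral_eq_lintegral_ofReal (hGi _ (hwA (φ n)).1)
              (ae_of_all _ (hGn _))]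
            refine ENNReal.ofReal_le_ofReal ((hwJ (φ n) u ⟨hu, hub⟩).trans ?_)
            have := Nat.one_div_le_one_div (α := ℝ) (hφ.id_le n)
            simp only [id] at this
            linarith
        _ = ENNReal.ofReal (J u) := by
            refine Tendsto.liminf_eq (ENNReal.tendsto_ofReal ?_)
            simpa using tendsto_const_nhds.add (tendsto_one_div_add_atTop_nhds_zero_nat (𝕜 := ℝ))
    exact (ENNReal.ofReal_le_ofReal_iff (hJ0 u)).1 hfat
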